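/- arXiv:2205.08021 — 4 statements merged into one kernel-verified Lean document; each statement's English description precedes it below -/
import Mathlib

section
/- Let R be a commutative local ring and n, q ≥ 1 integers with q ≤ 2n+1. Then for every A ∈ Skew_q^+(R) there exists a non-degenerate unimodular sequence u ∈ U_q(R^{2n}) which is in normal form and satisfies Γ(u) = A. -/
/-- The standard symplectic form `⟨x, y⟩ = ∑_{i=1}^{n} (x_{2i-1} y_{2i} - x_{2i} y_{2i-1})`
on `R^{2n}` (`0`-based indexing). -/
def sform {R : Type} [CommRing R] {n : ℕ} (x y : Fin (2 * n) → R) : R :=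
  ∑ i : Fin n,
    (x ⟨2 * i.val, by have := i.isLt; omega⟩ * y ⟨2 * i.val + 1, by have := i.isLt; omega⟩ -
      x ⟨2 * i.val + 1, by have := i.isLt; omega⟩ * y ⟨2 * i.val, by have := i.isLt; omega⟩)

/-- The Gram matrix `Γ(v) = (⟨v_i, v_j⟩)_{ij}` of a sequence of vectors in `R^{2n}`. -/
def gram {R : Type} [CommRing R] {n q : ℕ} (v : Fin q → Fin (2 * n) → R) :
    Matrix (Fin q) (Fin q) R :=
  Matrix.of fun i j => sform (v i) (v j)

/-- A sequence of `q` vectors of `R^{2n}` is unimodular if each subsequence of length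
`≤ min(q, 2n)` is a basis of a direct summand of `R^{2n}`. -/
def IsUnimodularSeq {R : Type} [CommRing R] {n q : ℕ} (v : Fin q → Fin (2 * n) → R) : Prop :=
  ∀ s : Finset (Fin q), s.card ≤ min q (2 * n) →
    LinearIndependent R (fun i : s => v i.val) ∧
    ∃ c : Submodule R (Fin (2 * n) → R),
      IsCompl (Submodule.span R (v '' (s : Set (Fin q)))) c

/-- A sequence of `q` vectors of `R^{2n}` is non-degenerate if for every subset `I` of even
cardinality `≤ min(q, 2n)` the Gram matrix of the corresponding subsequence is invertible. -/
def IsNondegenerateSeq {R : Type} [CommRing R] {n q : ℕ} (v : Fin q → Fin (2 * n) → R) :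
    Prop :=
  ∀ I : Finset (Fin q), Even I.card → I.card ≤ min q (2 * n) →
    IsUnit (Matrix.of fun i j : I => sform (v i.val) (v j.val))

/-- `U_q(R^{2n})`: the set of non-degenerate unimodular sequences of length `q` in `R^{2n}`. -/
def USet (R : Type) [CommRing R] (n q : ℕ) : Set (Fin q → Fin (2 * n) → R) :=
  {v | IsUnimodularSeq v ∧ IsNondegenerateSeq v}

open Matrix in
/-- `Skew_q^+(R)`: the set of skew-symmetric `q × q` matrices (`ᵀA = -A` with zero diagonal)
such that for every subset `I` of even cardinality the submatrix obtained by deleting all rows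
and columns not in `I` is invertible. -/
def SkewPlus (R : Type) [CommRing R] (q : ℕ) : Set (Matrix (Fin q) (Fin q) R) :=
  {A | Aᵀ = -A ∧ (∀ i, A i i = 0) ∧
    ∀ I : Finset (Fin q), Even I.card →
      IsUnit (A.submatrix (fun i : I => i.val) (fun i : I => i.val))}

/-- A sequence `u ∈ U_q(R^{2n})` is in normal form if, with `r = min(2n, q)`, the matrix
`(u_1, …, u_r)` is upper triangular, `(u_i)_i = 1` for odd `i ≤ r` and `(u_i)_{i-1} = 0` for
even `i ≤ r` (written `0`-based: column `j`, `j < r`, has `u j i = 0` for `i > j`, `u j j = 1`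
for even `j` and `u j (j - 1) = 0` for odd `j`). -/
def IsNormalForm {R : Type} [CommRing R] {n q : ℕ} (u : Fin q → Fin (2 * n) → R) : Prop :=
  (∀ j : Fin q, j.val < min (2 * n) q → ∀ i : Fin (2 * n), j.val < i.val → u j i = 0) ∧
  (∀ j : Fin q, ∀ hj : j.val < min (2 * n) q, Even j.val → u j ⟨j.val, by omega⟩ = 1) ∧
  (∀ j : Fin q, ∀ hj : j.val < min (2 * n) q, Odd j.val →
    u j ⟨j.val - 1, by omega⟩ = 0)

section SymplecticForm

variable {R : Type} [CommRing R] {n : ℕ}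

lemma sform_add_right (x y z : Fin (2 * n) → R) :
    sform x (y + z) = sform x y + sform x z := by
  simp only [sform, Pi.add_apply, ← Finset.sum_add_distrib]
  exact Finset.sum_congr rfl fun _ _ => by ring

lemma sform_smul_right (c : R) (x y : Fin (2 * n) → R) :
    sform x (c • y) = c * sform x y := by
  simp only [sform, Pi.smul_apply, smul_eq_mul, Finset.mul_sum]
  exact Finset.sum_congr rfl fun _ _ => by ring

/-- The linear functional `⟨x, ·⟩`. -/
def sformLeft (x : Fin (2 * n) → R) : (Fin (2 * n) → R) →ₗ[R] R where
  toFun := sform x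
  map_add' := sform_add_right x
  map_smul' c y := sform_smul_right c x y

@[simp]
lemma sformLeft_apply (x y : Fin (2 * n) → R) : sformLeft x y = sform x y := rfl

lemma sform_self (x : Fin (2 * n) → R) : sform x x = 0 :=
  Finset.sum_eq_zero fun _ _ => by ring

lemma sform_swap (x y : Fin (2 * n) → R) : sform x y = -sform y x := by
  simp only [sform, ← Finset.sum_neg_distrib]
  exact Finset.sum_congr rfl fun _ _ => by ring

lemma sform_single_odd (x : Fin (2 * n) → R) (k : ℕ) (hk : 2 * k + 1 < 2 * n) (c : R) :
    sform x (Pi.single ⟨2 * k + 1, hk⟩ c) = x ⟨2 * k, by omega⟩ * c := by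
  unfold sform
  rw [Finset.sum_eq_single ⟨k, by omega⟩]
  · simp
  · intro b _ hb
    have h1 : b.val ≠ k := fun h => hb (Fin.ext h)
    have h2 : 2 * b.val ≠ 2 * k + 1 := by omega
    simp [h1, h2]
  · simp

lemma sform_single_even (x : Fin (2 * n) → R) (k : ℕ) (hk : 2 * k < 2 * n) (c : R) :
    sform x (Pi.single ⟨2 * k, hk⟩ c) = -(x ⟨2 * k + 1, by omega⟩ * c) := by
  unfold sform
  rw [Finset.sum_eq_single ⟨k, by omega⟩]
  · simp
  · intro b _ hb
    have h1 : b.val ≠ k := fun h => hb (Fin.ext h)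
    have h2 : 2 * b.val + 1 ≠ 2 * k := by omega
    simp [h1, h2]
  · simp

end SymplecticForm

section DualFamily

variable {R : Type} [CommRing R] {M : Type} [AddCommGroup M] [Module R M]
  {ι : Type} [DecidableEq ι]

/-- The vectors `v i`, `i ∈ s`, admit a dual family of linear functionals. -/
def HasDualFamily (R : Type) [CommRing R] {M : Type} [AddCommGroup M] [Module R M]
    {ι : Type} [DecidableEq ι] (v : ι → M) (s : Finset ι) : Prop :=
  ∃ g : ι → M →ₗ[R] R, ∀ i ∈ s, ∀ j ∈ s, g i (v j) = if i = j then 1 else 0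

lemma HasDualFamily.mono {v : ι → M} {s t : Finset ι} (h : HasDualFamily R v t)
    (hst : s ⊆ t) : HasDualFamily R v s :=
  let ⟨g, hg⟩ := h
  ⟨g, fun i hi j hj => hg i (hst hi) j (hst hj)⟩

lemma HasDualFamily.insert {v : ι → M} {s : Finset ι} (h : HasDualFamily R v s) {a : ι}
    (φ : M →ₗ[R] R) (hφs : ∀ i ∈ s, φ (v i) = 0) (hφa : φ (v a) = 1) :
    HasDualFamily R v (Insert.insert a s) := by
  obtain ⟨g, hg⟩ := h
  refine ⟨fun i => if i = a then φ else g i - g i (v a) • φ, fun i hi j hj => ?_⟩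
  rw [Finset.mem_insert] at hi hj
  by_cases hia : i = a
  · subst hia
    by_cases hij : i = j
    · subst hij; simp [hφa]
    · have hjs : j ∈ s := hj.resolve_left (Ne.symm hij)
      simp [hij, hφs j hjs]
  · have his : i ∈ s := hi.resolve_left hia
    by_cases hja : j = a
    · subst hja; simp [hia, hφa]
    · have hjs : j ∈ s := hj.resolve_left hja
      simp [hia, hφs j hjs, hg i his j hjs]

lemma HasDualFamily.linearIndependent {v : ι → M} {s : Finset ι}
    (h : HasDualFamily R v s) : LinearIndependent R (fun i : s => v i.val) := by
  obtain ⟨g, hg⟩ := h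
  rw [Fintype.linearIndependent_iff]
  intro c hc i
  have := congrArg (g i) hc
  simpa [map_sum, hg i i.2, Subtype.ext_iff.symm] using this

lemma HasDualFamily.exists_isCompl {v : ι → M} {s : Finset ι} (h : HasDualFamily R v s) :
    ∃ c : Submodule R M, IsCompl (Submodule.span R (v '' (s : Set ι))) c := by
  obtain ⟨g, hg⟩ := h
  refine ⟨⨅ i ∈ s, LinearMap.ker (g i), ?_, ?_⟩
  · rw [Submodule.disjoint_def]
    intro x hx hx'
    simp only [Submodule.mem_iInf, LinearMap.mem_ker] at hx'
    have key : x = ∑ i ∈ s, g i x • v i := by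
      clear hx'
      induction hx using Submodule.span_induction with
      | mem x hx =>
        obtain ⟨j, hj, rfl⟩ := hx
        have hj' : j ∈ s := hj
        rw [Finset.sum_eq_single_of_mem j hj' fun i hi hij => by simp [hg i hi j hj', hij]]
        simp [hg j hj' j hj']
      | zero => simp
      | add x y _ _ hx hy =>
        simp only [map_add, add_smul, Finset.sum_add_distrib]
        rw [← hx, ← hy]
      | smul a x _ hx =>
        simp only [map_smul, smul_eq_mul, mul_smul, ← Finset.smul_sum]
        rw [← hx]
    rw [key]
    exact Finset.sum_eq_zero fun i hi => by rw [hx' i hi, zero_smul]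
  · rw [codisjoint_iff, eq_top_iff]
    intro x _
    rw [Submodule.mem_sup]
    refine ⟨∑ i ∈ s, g i x • v i, Submodule.sum_mem _ fun i hi =>
      Submodule.smul_mem _ _ (Submodule.subset_span ⟨i, hi, rfl⟩),
      x - ∑ i ∈ s, g i x • v i, ?_, by abel⟩
    simp only [Submodule.mem_iInf, LinearMap.mem_ker]
    intro i hi
    rw [map_sub, map_sum, Finset.sum_eq_single_of_mem i hi
      fun j hj hji => by simp [hg i hi j hj, hji.symm]]
    simp [hg i hi i hi]

end DualFamily

section NormalForm

variable {R : Type} [CommRing R] {n q : ℕ}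

lemma hasDualFamily_of_isUnit_gram {v : Fin q → Fin (2 * n) → R} {I : Finset (Fin q)}
    (h : IsUnit (Matrix.of fun i j : I => sform (v i.val) (v j.val))) :
    HasDualFamily R v I := by
  obtain ⟨B, hB⟩ := h.exists_left_inv
  refine ⟨fun i => if hi : i ∈ I then ∑ k : I, B ⟨i, hi⟩ k • sformLeft (v k) else 0,
    fun i hi j hj => ?_⟩
  have := congrFun (congrFun hB ⟨i, hi⟩) ⟨j, hj⟩
  rw [Matrix.mul_apply, Matrix.one_apply] at this
  simpa [hi] using this

lemma SkewPlus.submatrix_castSucc {A : Matrix (Fin (q + 1)) (Fin (q + 1)) R}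
    (hA : A ∈ SkewPlus R (q + 1)) :
    A.submatrix Fin.castSucc Fin.castSucc ∈ SkewPlus R q := by
  obtain ⟨h1, h2, h3⟩ := hA
  refine ⟨?_, fun i => h2 _, fun I hI => ?_⟩
  · ext i j
    exact congrFun (congrFun h1 i.castSucc) j.castSucc
  · have h := h3 (I.map Fin.castSuccEmb) (by simpa using hI)
    let e : I ≃ (I.map Fin.castSuccEmb : Finset (Fin (q + 1))) :=
      (Equiv.Set.image _ (I : Set (Fin q)) Fin.castSuccEmb.injective).trans
        (Equiv.setCongr (Finset.coe_map _ _).symm)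
    have := (Matrix.isUnit_submatrix_equiv (e₁ := e) (e₂ := e)).mpr h
    exact this

/-- Pairings with the first `m` vectors can be prescribed inside their span. -/
lemma exists_sform_eq {A : Matrix (Fin q) (Fin q) R} (hA : A ∈ SkewPlus R q)
    {u : Fin q → Fin (2 * n) → R} (hu : gram u = A)
    (htri : ∀ (j : Fin q) (i : Fin (2 * n)), j.val < i.val → u j i = 0)
    {m : ℕ} (hm : Even m) (hmq : m ≤ q) (a : Fin q → R) :
    ∃ w : Fin (2 * n) → R, (∀ i, m ≤ i.val → w i = 0) ∧
      ∀ j : Fin q, j.val < m → sform (u j) w = a j := by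
  let I : Finset (Fin q) := Finset.univ.map (Fin.castLEEmb hmq)
  have hI : ∀ j : Fin q, j ∈ I ↔ j.val < m := fun j => by
    simp only [I, Finset.mem_map, Finset.mem_univ, true_and]
    exact ⟨fun ⟨k, hk⟩ => hk ▸ k.2, fun h => ⟨⟨j, h⟩, rfl⟩⟩
  obtain ⟨B, hB⟩ := (hA.2.2 I (by simpa [I] using hm)).exists_right_inv
  refine ⟨∑ k : I, (B.mulVec fun i => a i) k • u k, fun i hi => ?_, fun j hj => ?_⟩
  · rw [Finset.sum_apply]
    refine Finset.sum_eq_zero fun k _ => ?_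
    have := (hI k).1 k.2
    simp [htri k i (by omega)]
  · have h := congrFun (congrArg (fun C => C.mulVec fun i : I => a i) hB) ⟨j, (hI j).2 hj⟩
    simp only [← Matrix.mulVec_mulVec, Matrix.one_mulVec] at h
    rw [← sformLeft_apply, map_sum, ← h]
    simp only [Matrix.mulVec, dotProduct, Matrix.submatrix_apply, map_smul, sformLeft_apply,
      smul_eq_mul, ← hu, gram, Matrix.of_apply]
    exact Finset.sum_congr rfl fun _ _ => mul_comm _ _

lemma gram_snoc {A : Matrix (Fin (q + 1)) (Fin (q + 1)) R} (hA : A ∈ SkewPlus R (q + 1))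
    {u : Fin q → Fin (2 * n) → R} (hu : gram u = A.submatrix Fin.castSucc Fin.castSucc)
    {v : Fin (2 * n) → R} (hv : ∀ j, sform (u j) v = A j.castSucc (Fin.last q)) :
    gram (Fin.snoc u v : Fin (q + 1) → Fin (2 * n) → R) = A := by
  ext i j
  simp only [gram, Matrix.of_apply]
  induction i using Fin.lastCases with
  | last =>
    induction j using Fin.lastCases with
    | last => simp [sform_self, hA.2.1]
    | cast j =>
      rw [Fin.snoc_last, Fin.snoc_castSucc, sform_swap, hv]
      have := congrFun (congrFun hA.1 (Fin.last q)) j.castSucc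
      simp only [Matrix.transpose_apply, Matrix.neg_apply] at this
      rw [this, neg_neg]
  | cast i =>
    induction j using Fin.lastCases with
    | last => simp [hv]
    | cast j =>
      simpa [gram] using congrFun (congrFun hu i) j

lemma isNormalForm_snoc {u : Fin q → Fin (2 * n) → R} (hu : IsNormalForm u)
    (hq : q ≤ 2 * n) {v : Fin (2 * n) → R}
    (htri : ∀ i : Fin (2 * n), q < i.val → v i = 0)
    (heven : ∀ h : q < 2 * n, Even q → v ⟨q, h⟩ = 1)
    (hodd : ∀ h : q < 2 * n, Odd q → v ⟨q - 1, by omega⟩ = 0) :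
    IsNormalForm (Fin.snoc u v : Fin (q + 1) → Fin (2 * n) → R) := by
  obtain ⟨h1, h2, h3⟩ := hu
  refine ⟨fun j hj => ?_, fun j hj => ?_, fun j hj => ?_⟩
  · induction j using Fin.lastCases with
    | last => simpa using htri
    | cast j => simpa using h1 j (by omega)
  · induction j using Fin.lastCases with
    | last =>
      rw [Fin.val_last] at hj
      simpa using heven (by omega)
    | cast j => simpa using h2 j (by omega)
  · induction j using Fin.lastCases with
    | last =>
      rw [Fin.val_last] at hj
      simpa using hodd (by omega)
    | cast j => simpa using h3 j (by omega)

/-- The next column of the normal form. -/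
lemma exists_next_column {A : Matrix (Fin q) (Fin q) R} (hA : A ∈ SkewPlus R q)
    (hq : q ≤ 2 * n) {u : Fin q → Fin (2 * n) → R} (hn : IsNormalForm u) (hu : gram u = A)
    (a : Fin q → R) :
    ∃ v : Fin (2 * n) → R, (∀ j, sform (u j) v = a j) ∧
      (∀ i : Fin (2 * n), q < i.val → v i = 0) ∧
      (∀ h : q < 2 * n, Even q → v ⟨q, h⟩ = 1) ∧
      (∀ h : q < 2 * n, Odd q → v ⟨q - 1, by omega⟩ = 0) := by
  have htri : ∀ (j : Fin q) (i : Fin (2 * n)), j.val < i.val → u j i = 0 :=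
    fun j i => hn.1 j (by omega) i
  rcases Nat.even_or_odd' q with ⟨k, rfl | rfl⟩
  · obtain ⟨w, hw0, hw⟩ := exists_sform_eq hA hu htri (even_two_mul k) le_rfl a
    have hnot : ¬ Odd (2 * k) := by simp
    by_cases hk : 2 * k < 2 * n
    · refine ⟨w + Pi.single ⟨2 * k, hk⟩ 1, fun j => ?_, fun i hi => ?_, fun _ _ => ?_,
        fun _ h => absurd h hnot⟩
      · rw [sform_add_right, sform_single_even, hw j j.2, htri j _ (by simp)]
        simp
      · simp [hw0 i hi.le, Fin.ext_iff, hi.ne']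
      · simp [hw0]
    · exact ⟨w, fun j => hw j j.2, fun i hi => hw0 i hi.le, fun h => absurd h hk,
        fun h => absurd h hk⟩
  · obtain ⟨w, hw0, hw⟩ := exists_sform_eq hA hu htri (even_two_mul k) (Nat.le_succ _) a
    have hnot : ¬ Even (2 * k + 1) := by simp
    have hk : 2 * k + 1 < 2 * n := by omega
    let l : Fin (2 * k + 1) := Fin.last _
    refine ⟨w + Pi.single ⟨2 * k + 1, hk⟩ (a l - sform (u l) w), fun j => ?_, fun i hi => ?_,
      fun _ h => absurd h hnot, fun _ _ => ?_⟩
    · rw [sform_add_right, sform_single_odd]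
      rcases Nat.lt_or_ge j.val (2 * k) with hj | hj
      · rw [hw j hj, htri j _ hj]
        simp
      · obtain rfl : j = l := Fin.ext (by simp [l]; omega)
        have h1 : u l ⟨2 * k, by omega⟩ = 1 := hn.2.1 l (by simp [l]; omega) (by simp [l])
        rw [h1]
        ring
    · simp [hw0 i (by omega), Fin.ext_iff, hi.ne']
    · simp [hw0]

lemma exists_isNormalForm_gram_eq (n : ℕ) : ∀ (q : ℕ), q ≤ 2 * n + 1 → ∀ A ∈ SkewPlus R q,
    ∃ u : Fin q → Fin (2 * n) → R, IsNormalForm u ∧ gram u = A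
  | 0, _, _, _ => ⟨fun j => j.elim0, ⟨fun j => j.elim0, fun j => j.elim0, fun j => j.elim0⟩,
      Subsingleton.elim _ _⟩
  | q + 1, hq, A, hA => by
    have hA' := SkewPlus.submatrix_castSucc hA
    obtain ⟨u, hn, hu⟩ := exists_isNormalForm_gram_eq n q (by omega) _ hA'
    obtain ⟨v, hv, h1, h2, h3⟩ := exists_next_column hA' (by omega) hn hu
      fun j => A j.castSucc (Fin.last q)
    exact ⟨Fin.snoc u v, isNormalForm_snoc hn (by omega) h1 h2 h3, gram_snoc hA hu hv⟩

lemma IsNormalForm.isUnimodularSeq {u : Fin q → Fin (2 * n) → R} (hn : IsNormalForm u)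
    (hu : IsNondegenerateSeq u) : IsUnimodularSeq u := by
  intro s hs
  suffices h : HasDualFamily R u s from ⟨h.linearIndependent, h.exists_isCompl⟩
  have heven : ∀ t : Finset (Fin q), Even t.card → t.card ≤ min q (2 * n) →
      HasDualFamily R u t := fun t h1 h2 => hasDualFamily_of_isUnit_gram (hu t h1 h2)
  rcases Nat.even_or_odd s.card with he | ho
  · exact heven s he hs
  by_cases hsu : s = Finset.univ
  · subst hsu
    rw [Finset.card_univ, Fintype.card_fin] at ho hs
    obtain ⟨k, rfl⟩ := ho
    let l : Fin (2 * k + 1) := Fin.last _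
    have hcard : (Finset.univ.erase l).card = 2 * k := by simp
    have hd := heven (Finset.univ.erase l) (by simp) (by omega)
    have hk : 2 * k < 2 * n := by omega
    have hl : u l ⟨2 * k, hk⟩ = 1 := hn.2.1 l (by simp [l]; omega) (by simp [l])
    let φ : (Fin (2 * n) → R) →ₗ[R] R := LinearMap.proj ⟨2 * k, hk⟩
    have := hd.insert (a := l) φ
      (fun i hi => hn.1 i (by omega) _ (by
        have := Finset.ne_of_mem_erase hi
        rw [Ne, Fin.ext_iff] at this
        simp only [l, Fin.val_last] at this ⊢
        omega)) hl
    rwa [Finset.insert_erase (Finset.mem_univ _)] at this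
  · obtain ⟨a, ha⟩ : ∃ a, a ∉ s := by
      by_contra! h
      exact hsu (Finset.eq_univ_iff_forall.2 h)
    have hc := Finset.card_insert_of_notMem ha
    have hle : (Insert.insert a s).card ≤ q := by
      simpa using Finset.card_le_univ (Insert.insert a s)
    refine (heven (Insert.insert a s) (hc ▸ ho.add_one) ?_).mono (Finset.subset_insert a s)
    obtain ⟨k, hk⟩ := ho
    omega

end NormalForm

/-- **Statement 6.**  Let `R` be a commutative local ring and `n, q ≥ 1` with `q ≤ 2n+1`.
For every `A ∈ Skew_q^+(R)` there is a non-degenerate unimodular sequence `u ∈ U_q(R^{2n})`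
in normal form with `Γ(u) = A`. -/
theorem skew_has_normal_form (R : Type) [CommRing R] [IsLocalRing R] (n q : ℕ)
    (hn : 1 ≤ n) (hq1 : 1 ≤ q) (hq : q ≤ 2 * n + 1) :
    ∀ A ∈ SkewPlus R q, ∃ u ∈ USet R n q, IsNormalForm u ∧ gram u = A := by
  intro A hA
  obtain ⟨u, hu, hg⟩ := exists_isNormalForm_gram_eq n q hq A hA
  have hd : IsNondegenerateSeq u := fun I hI _ => by
    subst hg
    exact hA.2.2 I hI
  exact ⟨u, ⟨hu.isUnimodularSeq hd, hd⟩, hu, hg⟩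
end

section
/- Let R be a commutative ring, M an abelian group, and t ≥ 1 an integer. Let [·,…,·] : R^t → M be a ℤ-multilinear map (additive in each of its t arguments). Let x = (x_1,…,x_m) be a sequence of m ≥ 1 elements of R and let p_1,…,p_t ∈ R[X] be polynomials of degrees γ_1,…,γ_t ≥ 0 with γ_1 + ⋯ + γ_t < m. Then −Σ_{∅≠J⊆{1,…,m}} (−1)^{|J|} [p_1(x_J),…,p_t(x_J)] = [p_1(0),…,p_t(0)], where x_J = Σ_{j∈J} x_j. -/
open Finset in
/-- The alternating sum over all supersets of a proper subset of a finite type vanishes. -/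
theorem Finset.sum_superset_neg_one_pow_card {ι : Type*} [Fintype ι] [DecidableEq ι]
    {U : Finset ι} (hU : U ≠ univ) :
    ∑ J with U ⊆ J, (-1 : ℤ) ^ #J = 0 := by
  obtain ⟨j, hj⟩ : ∃ j, j ∉ U := by
    by_contra! h
    exact hU (eq_univ_iff_forall.2 h)
  refine sum_involution (fun J _ ↦ if j ∈ J then J.erase j else insert j J) ?_ ?_ ?_ ?_
  · intro J _
    split_ifs with h
    · rw [← card_erase_add_one h]
      ring
    · rw [card_insert_of_notMem h]
      ring
  · intro J _ _
    split_ifs with h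
    · exact fun e ↦ notMem_erase j J (e.symm ▸ h)
    · exact fun e ↦ h (e ▸ mem_insert_self j J)
  · intro J hJ
    simp only [mem_filter, mem_univ, true_and] at hJ ⊢
    split_ifs with h
    · exact subset_erase.2 ⟨hJ, hj⟩
    · exact hJ.trans (subset_insert j J)
  · intro J _
    by_cases h : j ∈ J <;> simp [h]

open Finset in
/-- As a function of `J`, the value of a polynomial of degree `n` at the subset sum over `J` is
the zeta transform of a function supported on sets of cardinality at most `n`. -/
theorem Polynomial.exists_eval_sum_eq_sum_powerset {R ι : Type*} [CommRing R] [Fintype ι]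
    [DecidableEq ι] (p : Polynomial R) (x : ι → R) :
    ∃ a : Finset ι → R, (∀ A, p.natDegree < #A → a A = 0) ∧
      ∀ J, p.eval (∑ j ∈ J, x j) = ∑ A ∈ J.powerset, a A := by
  refine ⟨fun A ↦ ∑ k ∈ range (p.natDegree + 1), p.coeff k *
    ∑ c : Fin k → ι with univ.image c = A, ∏ l, x (c l), fun A hA ↦ ?_, fun J ↦ ?_⟩
  · refine sum_eq_zero fun k hk ↦ ?_
    rw [filter_eq_empty_iff.2, sum_empty, mul_zero]
    rintro c - rfl
    have := card_image_le (s := univ) (f := c)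
    simp only [card_univ, Fintype.card_fin, mem_range] at this hk
    omega
  · rw [eval_eq_sum_range, sum_comm]
    refine sum_congr rfl fun k _ ↦ ?_
    rw [← mul_sum, ← Fin.prod_const, prod_univ_sum]
    congr 1
    rw [← sum_fiberwise_of_maps_to (s := Fintype.piFinset fun _ ↦ J) (t := J.powerset)
      (g := fun c ↦ univ.image c)
      (fun c hc ↦ mem_powerset.2 <| image_subset_iff.2 fun l _ ↦ Fintype.mem_piFinset.1 hc l)]
    refine sum_congr rfl fun A hA ↦ sum_congr ?_ fun _ _ ↦ rfl
    ext c
    simp only [mem_filter, Fintype.mem_piFinset, mem_univ, true_and, and_iff_right_iff_imp]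
    rintro rfl l
    exact mem_powerset.1 hA (mem_image_of_mem c (mem_univ l))

open Finset in
/-- The alternating sum over all subsets `J` of a multilinear map evaluated at polynomials in the
subset sum over `J` vanishes when the total degree is less than the number of summands. -/
theorem MultilinearMap.sum_neg_one_pow_card_smul_eval_sum_eq_zero {R M ι κ : Type*} [CommRing R]
    [AddCommGroup M] [Fintype ι] [DecidableEq ι] [Fintype κ] [DecidableEq κ]
    (f : MultilinearMap ℤ (fun _ : κ ↦ R) M) (x : ι → R) (p : κ → Polynomial R)
    (hdeg : ∑ i, (p i).natDegree < Fintype.card ι) :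
    ∑ J : Finset ι, (-1 : ℤ) ^ #J • f (fun i ↦ (p i).eval (∑ j ∈ J, x j)) = 0 := by
  choose a ha hp using fun i ↦ (p i).exists_eval_sum_eq_sum_powerset x
  have hexp (J : Finset ι) : f (fun i ↦ (p i).eval (∑ j ∈ J, x j)) =
      ∑ A : κ → Finset ι, if univ.biUnion A ⊆ J then f (fun i ↦ a i (A i)) else 0 := by
    simp_rw [hp]
    rw [f.map_sum_finset (fun i A ↦ a i A) (fun _ ↦ J.powerset), ← sum_filter]
    refine sum_congr ?_ fun _ _ ↦ rfl
    ext A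
    simp
  simp_rw [hexp, smul_sum]
  rw [sum_comm]
  refine sum_eq_zero fun A _ ↦ ?_
  simp_rw [smul_ite, smul_zero]
  rw [← sum_filter, ← sum_smul]
  by_cases hA : univ.biUnion A = univ
  · obtain ⟨i, hi⟩ : ∃ i, (p i).natDegree < #(A i) := by
      by_contra! h
      refine hdeg.not_ge ?_
      calc Fintype.card ι = #(univ.biUnion A) := by rw [hA, card_univ]
        _ ≤ ∑ i, #(A i) := card_biUnion_le
        _ ≤ ∑ i, (p i).natDegree := sum_le_sum fun i _ ↦ h i
    rw [f.map_coord_zero i (ha i _ hi), smul_zero]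
  · rw [sum_superset_neg_one_pow_card hA, zero_smul]

/-- **Statement 9.**  Let `R` be a commutative ring, `M` an abelian group, `t ≥ 1`, and
`[·,…,·] : R^t → M` a `ℤ`-multilinear map.  For a sequence `x = (x_1, …, x_m)` in `R`,
`m ≥ 1`, and polynomials `p_1, …, p_t ∈ R[X]` with `∑ deg p_i < m`,
`-∑_{∅ ≠ J ⊆ {1,…,m}} (-1)^{|J|} [p_1(x_J), …, p_t(x_J)] = [p_1(0), …, p_t(0)]`, where
`x_J = ∑_{j ∈ J} x_j`. -/
theorem multilinear_inclusion_exclusion (R : Type) [CommRing R] (M : Type) [AddCommGroup M]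
    (t : ℕ) (ht : 1 ≤ t) (f : MultilinearMap ℤ (fun _ : Fin t => R) M)
    (m : ℕ) (hm : 1 ≤ m) (x : Fin m → R) (p : Fin t → Polynomial R)
    (hdeg : ∑ i : Fin t, (p i).natDegree < m) :
    -∑ J ∈ Finset.univ.powerset.filter (fun J : Finset (Fin m) => J ≠ ∅),
        (-1 : ℤ) ^ J.card • f (fun i => (p i).eval (∑ j ∈ J, x j))
      = f (fun i => (p i).eval 0) := by
  have h := f.sum_neg_one_pow_card_smul_eval_sum_eq_zero x p (by simpa using hdeg)
  rw [Finset.powerset_univ, Finset.filter_ne', neg_eq_iff_add_eq_zero, add_comm]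
  rw [← Finset.add_sum_erase _ _ (Finset.mem_univ ∅)] at h
  simpa using h
end

section
/- (Limit Theorem) Let R be a commutative local ring with infinite residue field, M a quasi-linear ℤ_0[R]-module, and x ∈ M. Let 𝒟 ⊆ R be a dense region of R and f : 𝒟 → ℤ_0[R] an admissible function with a given presentation. Assume that for every t ∈ 𝒟 some power of f(t) annihilates x, i.e. f(t) ∈ √Ann(x) ⊆ ℤ_0[R]. Then for every a ∈ R ∪ {∞}, if the limit lim_{t→a} f(t) exists in the given presentation, then lim_{t→a} f(t) ∈ √Ann(x). -/
/-- The element `⟨a⟩` of the monoid ring `ℤ[R]` of the multiplicative monoid `(R, ·, 1)`. -/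
noncomputable def bra (R : Type) [CommRing R] (a : R) : MonoidAlgebra ℤ R :=
  MonoidAlgebra.of ℤ R a

/-- The element `s_p(a) = -∑_{∅ ≠ J ⊆ {1,…,m}} (-1)^{|J|} ⟨p(a_J)⟩` of `ℤ[R]`, where
`a_J = ∑_{j ∈ J} a_j`. -/
noncomputable def sPoly {R : Type} [CommRing R] (p : Polynomial R) {m : ℕ} (a : Fin m → R) :
    MonoidAlgebra ℤ R :=
  -∑ J ∈ Finset.univ.powerset.filter (fun J : Finset (Fin m) => J ≠ ∅),
      (-1 : ℤ) ^ J.card • bra R (p.eval (∑ j ∈ J, a j))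

/-- The ring `ℤ_0[R] = ℤ[R]/ℤ⟨0⟩`. -/
noncomputable abbrev Z0 (R : Type) [CommRing R] : Type :=
  MonoidAlgebra ℤ R ⧸ Ideal.span {bra R 0}

/-- The class `⟨a⟩` in `ℤ_0[R]`. -/
noncomputable def Z0.of (R : Type) [CommRing R] (a : R) : Z0 R :=
  Ideal.Quotient.mk _ (bra R a)

/-- The element `s_p(a) ∈ ℤ_0[R]`. -/
noncomputable def sPoly0 {R : Type} [CommRing R] (p : Polynomial R) {m : ℕ} (a : Fin m → R) :
    Z0 R :=
  Ideal.Quotient.mk _ (sPoly p a)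

/-- A `ℤ_0[R]`-module `M` is quasi-linear if for every polynomial `p ∈ R[X]` there is
`m₀ ≥ 0` such that for all `m ≥ m₀` and all sequences `a = (a_1, …, a_m)` in `R`, every
element of `M` is annihilated by some power of `σ = s_p(a) - ⟨p(0)⟩`, i.e. `σ⁻¹M = 0`. -/
def IsQuasiLinear (R : Type) [CommRing R] (M : Type) [AddCommGroup M] [Module (Z0 R) M] :
    Prop :=
  ∀ p : Polynomial R, ∃ m₀ : ℕ, ∀ m : ℕ, m₀ ≤ m → ∀ a : Fin m → R, ∀ x : M,
    ∃ k : ℕ, (sPoly0 p a - Z0.of R (p.eval 0)) ^ k • x = 0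

/-- Evaluation of a presentation `(P; P_1, …, P_n; Q_1, …, Q_n)` of an admissible function at
`t ∈ R`: `P(⟨P_1(t)/Q_1(t)⟩, …, ⟨P_n(t)/Q_n(t)⟩) ∈ ℤ_0[R]`. -/
noncomputable def presEval {R : Type} [CommRing R] {nv : ℕ} (P : MvPolynomial (Fin nv) ℤ)
    (Ps Qs : Fin nv → Polynomial R) (t : R) : Z0 R :=
  MvPolynomial.aeval (fun i => Z0.of R ((Ps i).eval t * Ring.inverse ((Qs i).eval t))) P

/-- The limit at infinity of a presentation (when `deg P_i ≤ deg Q_i` and the leading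
coefficients of the `Q_i` are units): `P(⟨P̄_1(0)/Q̄_1(0)⟩, …)`, where
`P̄_i(0)` is the coefficient of `P_i` in degree `deg Q_i` and `Q̄_i(0)` is the leading
coefficient of `Q_i`. -/
noncomputable def presEvalInf {R : Type} [CommRing R] {nv : ℕ} (P : MvPolynomial (Fin nv) ℤ)
    (Ps Qs : Fin nv → Polynomial R) : Z0 R :=
  MvPolynomial.aeval
    (fun i => Z0.of R ((Ps i).coeff ((Qs i).natDegree) *
      Ring.inverse ((Qs i).leadingCoeff))) P

/-- Evaluation at `t` of formal `ℤ`-combinations of polynomials, `p ↦ ⟨p(t)⟩`. -/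
noncomputable def evalZ0 {R : Type} [CommRing R] (t : R) : MonoidAlgebra ℤ (Polynomial R) →ₐ[ℤ] Z0 R :=
  MonoidAlgebra.lift ℤ (Z0 R) (Polynomial R)
    (((Ideal.Quotient.mk (Ideal.span {bra R 0})).toMonoidHom.comp (MonoidAlgebra.of ℤ R)).comp
      (Polynomial.evalRingHom t).toMonoidHom)

lemma evalZ0_of {R : Type} [CommRing R] (t : R) (p : Polynomial R) :
    evalZ0 t (MonoidAlgebra.of ℤ _ p) = Z0.of R (p.eval t) := by
  rw [evalZ0, MonoidAlgebra.lift_of]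
  rfl

lemma Z0.of_mul (R : Type) [CommRing R] (a b : R) : Z0.of R (a * b) = Z0.of R a * Z0.of R b :=
  (congrArg (Ideal.Quotient.mk _) (map_mul (MonoidAlgebra.of ℤ R) a b)).trans (map_mul _ _ _)

lemma Z0.of_one (R : Type) [CommRing R] : Z0.of R 1 = 1 :=
  (congrArg (Ideal.Quotient.mk _) (map_one (MonoidAlgebra.of ℤ R))).trans (map_one _)

lemma Z0.isUnit_of {R : Type} [CommRing R] {a : R} (h : IsUnit a) : IsUnit (Z0.of R a) := by
  obtain ⟨b, hb⟩ := h.exists_right_inv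
  exact IsUnit.of_mul_eq_one (Z0.of R b) (by rw [← Z0.of_mul, hb, Z0.of_one])

/-- Clearing denominators in a presentation. -/
lemma exists_evalZ0_eq_mul_presEval {R : Type} [CommRing R] {nv : ℕ}
    (P : MvPolynomial (Fin nv) ℤ) (Ps Qs : Fin nv → Polynomial R) :
    ∃ (G : MonoidAlgebra ℤ (Polynomial R)) (q : Polynomial R), ∀ t : R,
      (∀ i, IsUnit ((Qs i).eval t)) →
        IsUnit (q.eval t) ∧ evalZ0 t G = Z0.of R (q.eval t) * presEval P Ps Qs t := by
  induction P using MvPolynomial.induction_on with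
  | C n =>
    refine ⟨algebraMap ℤ _ n, 1, fun t _ => ⟨by simp, ?_⟩⟩
    rw [AlgHom.commutes, presEval, MvPolynomial.aeval_C, Polynomial.eval_one, Z0.of_one, one_mul]
  | add p q hp hq =>
    obtain ⟨G₁, q₁, h₁⟩ := hp
    obtain ⟨G₂, q₂, h₂⟩ := hq
    refine ⟨G₁ * MonoidAlgebra.of ℤ _ q₂ + G₂ * MonoidAlgebra.of ℤ _ q₁, q₁ * q₂,
      fun t ht => ⟨?_, ?_⟩⟩
    · rw [Polynomial.eval_mul]
      exact (h₁ t ht).1.mul (h₂ t ht).1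
    · rw [map_add, map_mul, map_mul, evalZ0_of, evalZ0_of, (h₁ t ht).2, (h₂ t ht).2,
        Polynomial.eval_mul, Z0.of_mul]
      simp only [presEval, map_add]
      ring
  | mul_X p i hp =>
    obtain ⟨G, q, h⟩ := hp
    refine ⟨G * MonoidAlgebra.of ℤ _ (Ps i), q * Qs i, fun t ht => ⟨?_, ?_⟩⟩
    · rw [Polynomial.eval_mul]
      exact (h t ht).1.mul (ht i)
    · have hinv : Z0.of R ((Ps i).eval t) = Z0.of R ((Qs i).eval t) *
          Z0.of R ((Ps i).eval t * Ring.inverse ((Qs i).eval t)) := by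
        rw [← Z0.of_mul, mul_left_comm, Ring.mul_inverse_cancel _ (ht i), mul_one]
      rw [map_mul, evalZ0_of, (h t ht).2, hinv, Polynomial.eval_mul, Z0.of_mul R (q.eval t)]
      simp only [presEval, map_mul, MvPolynomial.aeval_X]
      ring

/-- If every `s_p(a) - ⟨p(0)⟩` with long enough `a` lies in `I`, then all sufficiently high
iterated differences of `t ↦ evalZ0 t G` lie in `I`. -/
lemma exists_sum_evalZ0_mem {R : Type} [CommRing R] {I : Ideal (Z0 R)}
    (hI : ∀ p : Polynomial R, ∃ m₀ : ℕ, ∀ m : ℕ, m₀ ≤ m → ∀ a : Fin m → R,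
      sPoly0 p a - Z0.of R (p.eval 0) ∈ I)
    (G : MonoidAlgebra ℤ (Polynomial R)) (b : R) :
    ∃ m₀ : ℕ, ∀ m : ℕ, m₀ ≤ m → ∀ a : Fin m → R,
      ∑ J : Finset (Fin m), (-1 : ℤ) ^ J.card • evalZ0 (b + ∑ j ∈ J, a j) G ∈ I := by
  induction G using MonoidAlgebra.induction_on with
  | of p =>
    obtain ⟨m₀, h⟩ := hI (p.comp (Polynomial.X + Polynomial.C b))
    refine ⟨m₀, fun m hm a => ?_⟩
    have key := I.neg_mem (h m hm a)
    convert key using 1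
    rw [← Finset.add_sum_erase _ _ (Finset.mem_univ ∅)]
    simp only [sPoly0, sPoly, evalZ0_of, map_neg, map_sum, map_zsmul, Polynomial.eval_comp,
      Polynomial.eval_add, Polynomial.eval_X, Polynomial.eval_C, Finset.powerset_univ,
      Finset.card_empty, pow_zero, one_smul, Finset.sum_empty, zero_add,
      Finset.filter_ne', neg_sub, sub_neg_eq_add, add_comm b]
    rfl
  | add G₁ G₂ h₁ h₂ =>
    obtain ⟨m₁, h₁⟩ := h₁
    obtain ⟨m₂, h₂⟩ := h₂
    refine ⟨max m₁ m₂, fun m hm a => ?_⟩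
    simp only [map_add, smul_add, Finset.sum_add_distrib]
    exact I.add_mem (h₁ m (le_of_max_le_left hm) a) (h₂ m (le_of_max_le_right hm) a)
  | smul n G h =>
    obtain ⟨m₀, h⟩ := h
    refine ⟨m₀, fun m hm a => ?_⟩
    simp only [map_smul, smul_comm _ n, ← Finset.smul_sum]
    exact zsmul_mem (h m hm a) n

/-- In a dense region one finds arbitrarily many elements all of whose nonempty subsums, translated
by `b`, lie in the region. -/
lemma exists_forall_add_sum_mem {R k : Type} [CommRing R] [Field k] [Infinite k] (π : R →+* k)
    (hπ : Function.Surjective π) {E : Set k} (hE : Eᶜ.Finite) (b : R) {ι : Type} [DecidableEq ι]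
    (S : Finset ι) :
    ∃ a : ι → R, ∀ J ⊆ S, J ≠ ∅ → π (b + ∑ j ∈ J, a j) ∈ E := by
  induction S using Finset.induction_on with
  | empty => exact ⟨0, fun J hJ hne => absurd (Finset.subset_empty.mp hJ) hne⟩
  | insert i S hi ih =>
    obtain ⟨a, ha⟩ := ih
    have hfin : (⋃ J ∈ S.powerset, (fun c => π (b + ∑ j ∈ J, a j) + c) ⁻¹' Eᶜ).Finite :=
      S.powerset.finite_toSet.biUnion fun J _ =>
        hE.preimage (add_right_injective _).injOn
    obtain ⟨c', hc'⟩ := hfin.infinite_compl.nonempty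
    obtain ⟨c, rfl⟩ := hπ c'
    have hc : ∀ J ⊆ S, π (b + ∑ j ∈ J, a j) + π c ∈ E := by
      simpa using hc'
    have hupd : ∀ J : Finset ι, i ∉ J → ∑ j ∈ J, Function.update a i c j = ∑ j ∈ J, a j :=
      fun J hJ => Finset.sum_congr rfl fun j hj =>
        Function.update_of_ne (ne_of_mem_of_not_mem hj hJ) _ _
    refine ⟨Function.update a i c, fun J hJ hne => ?_⟩
    by_cases hiJ : i ∈ J
    · rw [← Finset.add_sum_erase _ _ hiJ, hupd _ (Finset.notMem_erase i J),
        Function.update_self, add_left_comm, map_add, add_comm]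
      exact hc _ (Finset.subset_insert_iff.mp hJ)
    · rw [hupd J hiJ]
      exact ha J ((Finset.subset_insert_iff_of_notMem hiJ).mp hJ) hne

/-- The limit theorem at a point of `R`, for an ideal in place of `√Ann(x)`. -/
lemma presEval_mem_of_dense {R k : Type} [CommRing R] [Field k] [Infinite k] (π : R →+* k)
    (hπ : Function.Surjective π) {E : Set k} (hE : Eᶜ.Finite) {I : Ideal (Z0 R)}
    (hI : ∀ p : Polynomial R, ∃ m₀ : ℕ, ∀ m : ℕ, m₀ ≤ m → ∀ a : Fin m → R,
      sPoly0 p a - Z0.of R (p.eval 0) ∈ I)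
    {nv : ℕ} (P : MvPolynomial (Fin nv) ℤ) (Ps Qs : Fin nv → Polynomial R)
    (hQ : ∀ t, π t ∈ E → ∀ i, IsUnit ((Qs i).eval t))
    (hP : ∀ t, π t ∈ E → presEval P Ps Qs t ∈ I)
    {b : R} (hb : ∀ i, IsUnit ((Qs i).eval b)) : presEval P Ps Qs b ∈ I := by
  obtain ⟨G, q, hG⟩ := exists_evalZ0_eq_mul_presEval P Ps Qs
  obtain ⟨m, hm⟩ := exists_sum_evalZ0_mem hI G b
  obtain ⟨a, ha⟩ := exists_forall_add_sum_mem π hπ hE b (Finset.univ : Finset (Fin m))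
  have hsum := hm m le_rfl a
  rw [← Finset.add_sum_erase _ _ (Finset.mem_univ ∅)] at hsum
  have hrest : ∑ J ∈ Finset.univ.erase (∅ : Finset (Fin m)),
      (-1 : ℤ) ^ J.card • evalZ0 (b + ∑ j ∈ J, a j) G ∈ I := by
    refine I.sum_mem fun J hJ => zsmul_mem ?_ _
    have hJE := ha J (Finset.subset_univ J) (Finset.ne_of_mem_erase hJ)
    rw [(hG _ (hQ _ hJE)).2]
    exact I.mul_mem_left _ (hP _ hJE)
  have hGb := (I.add_mem_iff_left hrest).mp hsum
  simp only [Finset.card_empty, pow_zero, one_smul, Finset.sum_empty, add_zero] at hGb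
  rw [(hG b hb).2] at hGb
  exact (Ideal.unit_mul_mem_iff_mem I (Z0.isUnit_of (hG b hb).1)).mp hGb

lemma eval_reflect_units {R : Type} [CommRing R] {p : Polynomial R} {N : ℕ}
    (hp : p.natDegree ≤ N) (u : Rˣ) :
    (p.reflect N).eval (u : R) = p.eval (↑u⁻¹ : R) * ((u ^ N : Rˣ) : R) := by
  let _ : Invertible (↑u⁻¹ : R) := ⟨u, u.mul_inv, u.inv_mul⟩
  have h := Polynomial.eval₂_reflect_mul_pow (RingHom.id R) (↑u⁻¹ : R) N p hp
  change (p.reflect N).eval (u : R) * (↑u⁻¹ : R) ^ N = p.eval (↑u⁻¹ : R) at h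
  rw [← h, mul_assoc, Units.val_pow_eq_pow_val, ← mul_pow, Units.inv_mul, one_pow, mul_one]

lemma eval_reflect_mul_inverse {R : Type} [CommRing R] {p q : Polynomial R} {N : ℕ}
    (hp : p.natDegree ≤ N) (hq : q.natDegree ≤ N) (u : Rˣ) :
    (p.reflect N).eval ↑u * Ring.inverse ((q.reflect N).eval ↑u) =
      p.eval ↑u⁻¹ * Ring.inverse (q.eval ↑u⁻¹) := by
  rw [eval_reflect_units hp, eval_reflect_units hq, Ring.mul_inverse_rev, Ring.inverse_unit]
  rw [mul_assoc, ← mul_assoc ((u ^ N : Rˣ) : R), Units.mul_inv, one_mul]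

/-- **Statement 12 (Limit Theorem).**  Let `R` be a commutative local ring with infinite
residue field, `M` a quasi-linear `ℤ_0[R]`-module and `x ∈ M`.  Let `𝒟 ⊆ R` be a dense
region and `f : 𝒟 → ℤ_0[R]` an admissible function with presentation `(P; P_i; Q_i)` such
that `f(t) ∈ √Ann(x)` for all `t ∈ 𝒟`.  Then for every `a ∈ R ∪ {∞}` at which the limit of
`f` exists (in the given presentation), the limit lies in `√Ann(x)`. -/
theorem limit_theorem (R : Type) [CommRing R] [IsLocalRing R]
    [Infinite (IsLocalRing.ResidueField R)]
    (M : Type) [AddCommGroup M] [Module (Z0 R) M] (hql : IsQuasiLinear R M) (x : M)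
    (D : Set R) (hregion : D = IsLocalRing.residue R ⁻¹' (IsLocalRing.residue R '' D))
    (hdense : Set.Finite ((IsLocalRing.residue R '' D)ᶜ))
    (nv : ℕ) (P : MvPolynomial (Fin nv) ℤ) (Ps Qs : Fin nv → Polynomial R)
    (hQ : ∀ t ∈ D, ∀ i, IsUnit ((Qs i).eval t))
    (f : R → Z0 R) (hf : ∀ t ∈ D, f t = presEval P Ps Qs t)
    (hann : ∀ t ∈ D, ∃ k : ℕ, f t ^ k • x = 0) :
    (∀ a : R, (∀ i, IsUnit ((Qs i).eval a)) →
      ∃ k : ℕ, (presEval P Ps Qs a) ^ k • x = 0) ∧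
    ((∀ i, (Ps i).degree ≤ (Qs i).degree ∧ IsUnit ((Qs i).leadingCoeff)) →
      ∃ k : ℕ, (presEvalInf P Ps Qs) ^ k • x = 0) := by
  have hI : ∀ p : Polynomial R, ∃ m₀ : ℕ, ∀ m : ℕ, m₀ ≤ m → ∀ a : Fin m → R,
      sPoly0 p a - Z0.of R (p.eval 0) ∈ (Ideal.torsionOf (Z0 R) M x).radical := fun p =>
    (hql p).imp fun _ h m hm a => h m hm a x
  have hD : ∀ t, IsLocalRing.residue R t ∈ IsLocalRing.residue R '' D → t ∈ D := fun t ht => by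
    rw [hregion]
    exact ht
  have hP : ∀ t ∈ D, presEval P Ps Qs t ∈ (Ideal.torsionOf (Z0 R) M x).radical := fun t ht => by
    rw [← hf t ht]
    exact hann t ht
  refine ⟨fun a ha => presEval_mem_of_dense (IsLocalRing.residue R) IsLocalRing.residue_surjective
    hdense hI P Ps Qs (fun t ht => hQ t (hD t ht)) (fun t ht => hP t (hD t ht)) ha, fun hdeg => ?_⟩
  have hN : ∀ i, (Ps i).natDegree ≤ (Qs i).natDegree := fun i =>
    Polynomial.natDegree_le_natDegree (hdeg i).1
  let E := {s | s ≠ 0 ∧ s⁻¹ ∈ IsLocalRing.residue R '' D}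
  have hE : Eᶜ.Finite := by
    refine ((Set.finite_singleton 0).union (hdense.preimage inv_injective.injOn)).subset
      fun s hs => ?_
    by_cases h0 : s = 0
    · exact Or.inl h0
    · exact Or.inr fun h => hs ⟨h0, h⟩
  have hunit : ∀ t, IsLocalRing.residue R t ∈ E → ∃ u : Rˣ, ↑u = t ∧ (↑u⁻¹ : R) ∈ D := by
    rintro t ⟨h0, h⟩
    obtain ⟨u, rfl⟩ := (IsLocalRing.residue_ne_zero_iff_isUnit t).mp h0
    refine ⟨u, rfl, hD _ ?_⟩
    rwa [map_units_inv]
  have h0 : presEval P (fun i => (Ps i).reflect (Qs i).natDegree)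
      (fun i => (Qs i).reflect (Qs i).natDegree) 0 = presEvalInf P Ps Qs := by
    simp only [presEval, presEvalInf, ← Polynomial.coeff_zero_eq_eval_zero,
      Polynomial.coeff_reflect, Polynomial.revAt_zero]
    rfl
  have hmem := presEval_mem_of_dense (IsLocalRing.residue R) IsLocalRing.residue_surjective
    hE hI P (fun i => (Ps i).reflect (Qs i).natDegree)
      (fun i => (Qs i).reflect (Qs i).natDegree) ?_ ?_ (b := 0) ?_
  · rwa [h0] at hmem
  · intro t ht i
    obtain ⟨u, rfl, hu⟩ := hunit t ht
    rw [eval_reflect_units le_rfl]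
    exact (hQ _ hu i).mul (Units.isUnit _)
  · intro t ht
    obtain ⟨u, rfl, hu⟩ := hunit t ht
    convert hP _ hu using 1
    simp only [presEval, eval_reflect_mul_inverse (hN _) le_rfl]
  · intro i
    rw [← Polynomial.coeff_zero_eq_eval_zero, Polynomial.coeff_reflect, Polynomial.revAt_zero]
    exact (hdeg i).2
end

section
/- Let R be a commutative local ring with infinite residue field. If M is a quasi-linear ℤ_0[R]-module on which ⟨a⟩ acts as the identity for every unit a ∈ R^*, then M = 0. -/
/-- An infinite abelian group contains families, over any finite set of indices, all of whose
nonempty partial sums are nonzero. -/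
theorem exists_forall_nonempty_sum_ne_zero {ι K : Type*} [AddCommGroup K] [Infinite K]
    (s : Finset ι) : ∃ a : ι → K, ∀ J ⊆ s, J.Nonempty → ∑ j ∈ J, a j ≠ 0 := by
  classical
  induction s using Finset.induction_on with
  | empty => exact ⟨0, fun J hJ hne => absurd (Finset.subset_empty.mp hJ) hne.ne_empty⟩
  | insert i s hi ih =>
    obtain ⟨a, ha⟩ := ih
    obtain ⟨c, hc⟩ := Infinite.exists_notMem_finset (s.powerset.image fun J => -∑ j ∈ J, a j)
    have hsum : ∀ J ⊆ s, ∑ j ∈ J, Function.update a i c j = ∑ j ∈ J, a j := fun J hJ =>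
      Finset.sum_congr rfl fun j hj =>
        Function.update_of_ne (ne_of_mem_of_not_mem (hJ hj) hi) _ _
    refine ⟨Function.update a i c, fun J hJ hne => ?_⟩
    by_cases hiJ : i ∈ J
    · have hsub : J.erase i ⊆ s := Finset.subset_insert_iff.mp hJ
      rw [← Finset.add_sum_erase J _ hiJ, hsum _ hsub, Function.update_self]
      exact fun h => hc (Finset.mem_image.mpr
        ⟨J.erase i, Finset.mem_powerset.mpr hsub, (eq_neg_of_add_eq_zero_left h).symm⟩)
    · have hsub : J ⊆ s := (Finset.subset_insert_iff_of_notMem hiJ).mp hJ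
      rw [hsum J hsub]
      exact ha J hsub hne

/-- A local ring with infinite residue field contains finite families of any length all of whose
nonempty partial sums are units. -/
theorem IsLocalRing.exists_forall_nonempty_isUnit_sum {R ι : Type*} [CommRing R] [IsLocalRing R]
    [Infinite (IsLocalRing.ResidueField R)] (s : Finset ι) :
    ∃ a : ι → R, ∀ J ⊆ s, J.Nonempty → IsUnit (∑ j ∈ J, a j) := by
  obtain ⟨b, hb⟩ := exists_forall_nonempty_sum_ne_zero (K := IsLocalRing.ResidueField R) s
  choose a ha using fun i => IsLocalRing.residue_surjective (b i)
  refine ⟨a, fun J hJ hne => (IsLocalRing.residue_ne_zero_iff_isUnit _).mp ?_⟩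
  simpa only [map_sum, ha] using hb J hJ hne

/-- The alternating sum of signs over the nonempty subsets of a nonempty finite set is `-1`. -/
theorem sum_nonempty_powerset_neg_one_pow_card {ι : Type*} [DecidableEq ι] {s : Finset ι}
    (hs : s.Nonempty) : ∑ J ∈ s.powerset.filter (fun J => J ≠ ∅), (-1 : ℤ) ^ J.card = -1 := by
  have h := Finset.sum_powerset_neg_one_pow_card_of_nonempty hs
  rw [← Finset.add_sum_erase _ _ (Finset.empty_mem_powerset s)] at h
  rw [Finset.filter_ne']
  simpa using eq_neg_of_add_eq_zero_right h

theorem Z0.of_zero (R : Type) [CommRing R] : Z0.of R 0 = 0 :=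
  Ideal.Quotient.eq_zero_iff_mem.mpr (Ideal.subset_span rfl)

/-- If units act trivially and `p` takes unit values on all nonempty partial sums of a nonempty
sequence `a`, then `s_p(a)` acts as the identity. -/
theorem sPoly0_smul_eq_self {R : Type} [CommRing R] {M : Type} [AddCommGroup M] [Module (Z0 R) M]
    (htriv : ∀ a : R, IsUnit a → ∀ x : M, Z0.of R a • x = x) (p : Polynomial R) {m : ℕ}
    (hm : 0 < m) (a : Fin m → R)
    (ha : ∀ J : Finset (Fin m), J.Nonempty → IsUnit (p.eval (∑ j ∈ J, a j))) (x : M) :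
    sPoly0 p a • x = x := by
  have hs : sPoly0 p a = -∑ J ∈ Finset.univ.powerset.filter (fun J : Finset (Fin m) => J ≠ ∅),
      (-1 : ℤ) ^ J.card • Z0.of R (p.eval (∑ j ∈ J, a j)) := by
    simp only [sPoly0, sPoly, Z0.of, map_neg, map_sum, map_zsmul]
  have hterm : ∀ J ∈ Finset.univ.powerset.filter (fun J : Finset (Fin m) => J ≠ ∅),
      ((-1 : ℤ) ^ J.card • Z0.of R (p.eval (∑ j ∈ J, a j))) • x = (-1 : ℤ) ^ J.card • x := by
    intro J hJ
    rw [smul_assoc, htriv _ (ha J (Finset.nonempty_iff_ne_empty.mpr (Finset.mem_filter.mp hJ).2))]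
  rw [hs, neg_smul, Finset.sum_smul, Finset.sum_congr rfl hterm, ← Finset.sum_smul,
    sum_nonempty_powerset_neg_one_pow_card ⟨⟨0, hm⟩, Finset.mem_univ _⟩, neg_one_smul, neg_neg]

/-- **Statement 13.**  Let `R` be a commutative local ring with infinite residue field.  If
`M` is a quasi-linear `ℤ_0[R]`-module on which `⟨a⟩` acts as the identity for every unit
`a ∈ R^*`, then `M = 0`. -/
theorem quasiLinear_trivial_action_eq_zero (R : Type) [CommRing R] [IsLocalRing R]
    [Infinite (IsLocalRing.ResidueField R)]
    (M : Type) [AddCommGroup M] [Module (Z0 R) M] (hql : IsQuasiLinear R M)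
    (htriv : ∀ a : R, IsUnit a → ∀ x : M, Z0.of R a • x = x) :
    ∀ x : M, x = 0 := by
  intro x
  obtain ⟨m₀, hm₀⟩ := hql Polynomial.X
  obtain ⟨a, ha⟩ := IsLocalRing.exists_forall_nonempty_isUnit_sum (R := R)
    (Finset.univ : Finset (Fin (m₀ + 1)))
  obtain ⟨k, hk⟩ := hm₀ (m₀ + 1) m₀.le_succ a x
  have hfix : ∀ y : M, sPoly0 Polynomial.X a • y = y :=
    sPoly0_smul_eq_self htriv _ m₀.succ_pos a fun J hJ => by
      simpa only [Polynomial.eval_X] using ha J (Finset.subset_univ J) hJ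
  rw [Polynomial.eval_X, Z0.of_zero, sub_zero, ← smul_iterate_apply] at hk
  rwa [Function.iterate_fixed (hfix x)] at hk
end
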